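/- Fix reals y > 0, h > 0, x, and velocities V₁, V₂ > 0. Define F(q, t) = y·(1/V₁² + q²)^{1/2} + h·(1/V₂² + q²)^{1/2} + iqx − t using the principal square root. For every t > t₀ (t₀ being the minimum over real p of the travel-time function), the equation F(q,t) = 0 has exactly one root q = γ(t) with Re(γ(t)) > 0. -/

import Mathlib

open Complex Set Filter Topology Metric

/-- A holomorphic function on a convex set whose derivative has positive real part is injective
(the Noshiro-Warschawski theorem). -/
theorem injOn_of_re_deriv_pos {U : Set ℂ} (hU : Convex ℝ U) {f f' : ℂ → ℂ}
    (hf : ∀ z ∈ U, HasDerivAt f (f' z) z) (hpos : ∀ z ∈ U, 0 < (f' z).re) : InjOn f U := by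
  intro p hp q hq hpq
  by_contra hne
  set d : ℂ := q - p with hd
  have hd0 : d ≠ 0 := sub_ne_zero.mpr (Ne.symm hne)
  have hmem : ∀ s ∈ Icc (0 : ℝ) 1, p + (s : ℂ) * d ∈ U := by
    intro s hs
    simpa [hd] using hU.add_smul_sub_mem hp hq hs
  have hderiv : ∀ s ∈ Icc (0 : ℝ) 1,
      HasDerivAt (fun s : ℝ ↦ (starRingEnd ℂ d * f (p + (s : ℂ) * d)).re)
        (starRingEnd ℂ d * (f' (p + (s : ℂ) * d) * d)).re s := by
    intro s hs
    have hline : HasDerivAt (fun z : ℂ ↦ p + z * d) d (s : ℂ) := by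
      simpa using ((hasDerivAt_id (s : ℂ)).mul_const d).const_add p
    exact (((hf _ (hmem s hs)).comp (s : ℂ) hline).const_mul _).real_of_complex
  obtain ⟨c, hc, hc0⟩ := exists_hasDerivAt_eq_zero zero_lt_one
    (fun s hs ↦ (hderiv s hs).continuousAt.continuousWithinAt)
    (by simp [hd, hpq]) fun s hs ↦ hderiv s (Ioo_subset_Icc_self hs)
  have hnorm : starRingEnd ℂ d * (f' (p + (c : ℂ) * d) * d)
      = (normSq d : ℂ) * f' (p + (c : ℂ) * d) := by
    rw [normSq_eq_conj_mul_self]; ring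
  rw [hnorm, re_ofReal_mul] at hc0
  exact (mul_pos (normSq_pos.mpr hd0) (hpos _ (hmem c (Ioo_subset_Icc_self hc)))).ne' hc0

/-- The vertical slowness `(a² + q²)^{1/2}`, with the principal square root. -/
noncomputable def verticalSlowness (a : ℝ) (q : ℂ) : ℂ := ((a : ℂ) ^ 2 + q ^ 2) ^ ((1 : ℂ) / 2)

theorem verticalSlowness_sq (a : ℝ) (q : ℂ) :
    verticalSlowness a q ^ 2 = (a : ℂ) ^ 2 + q ^ 2 := by
  simp [verticalSlowness]

theorem sq_add_sq_mem_slitPlane (a : ℝ) {q : ℂ} (hq : 0 < q.re) :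
    (a : ℂ) ^ 2 + q ^ 2 ∈ slitPlane := by
  rw [mem_slitPlane_iff]
  rcases eq_or_ne q.im 0 with h | h
  · left
    simp [pow_two, h]
    nlinarith [mul_pos hq hq, mul_self_nonneg a]
  · right
    simp only [pow_two, add_im, mul_im, ofReal_re, ofReal_im]
    intro h0
    apply mul_ne_zero hq.ne' h
    linarith

theorem verticalSlowness_re_pos (a : ℝ) {q : ℂ} (hq : 0 < q.re) :
    0 < (verticalSlowness a q).re := by
  have hs := sq_add_sq_mem_slitPlane a hq
  have harg := mem_slitPlane_iff_arg.mp hs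
  rw [verticalSlowness, cpow_def_of_ne_zero harg.2, exp_re]
  have him : (log ((a : ℂ) ^ 2 + q ^ 2) * (1 / 2)).im = arg ((a : ℂ) ^ 2 + q ^ 2) / 2 := by
    rw [← log_im, one_div, ← div_eq_mul_inv]; exact div_ofNat_im _ 2
  rw [him]
  refine mul_pos (Real.exp_pos _) (Real.cos_pos_of_mem_Ioo ⟨?_, ?_⟩)
  · linarith [neg_pi_lt_arg ((a : ℂ) ^ 2 + q ^ 2)]
  · linarith [lt_of_le_of_ne (arg_le_pi ((a : ℂ) ^ 2 + q ^ 2)) harg.1]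

theorem eq_verticalSlowness {a : ℝ} {q s : ℂ} (hq : 0 < q.re) (hs : 0 ≤ s.re)
    (h : s ^ 2 = (a : ℂ) ^ 2 + q ^ 2) : s = verticalSlowness a q := by
  rw [← verticalSlowness_sq] at h
  rcases sq_eq_sq_iff_eq_or_eq_neg.mp h with h | h
  · exact h
  · have := verticalSlowness_re_pos a hq
    rw [h, neg_re] at hs
    linarith

theorem re_mul_im_eq_of_sq_eq {a : ℝ} {q s : ℂ} (h : s ^ 2 = (a : ℂ) ^ 2 + q ^ 2) :
    s.re * s.im = q.re * q.im := by
  have := congrArg im h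
  simp only [pow_two, add_im, mul_im, ofReal_re, ofReal_im] at this
  linarith

theorem verticalSlowness_im_mul_nonneg (a : ℝ) {q : ℂ} (hq : 0 < q.re) :
    0 ≤ (verticalSlowness a q).im * q.im := by
  have hs := verticalSlowness_re_pos a hq
  have h := re_mul_im_eq_of_sq_eq (verticalSlowness_sq a q)
  refine nonneg_of_mul_nonneg_right ?_ hs
  rw [← mul_assoc, h, mul_assoc]
  exact mul_nonneg hq.le (mul_self_nonneg _)

theorem norm_verticalSlowness_sub_le {a : ℝ} (ha : 0 ≤ a) {q : ℂ} (hq : 0 < q.re) :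
    ‖verticalSlowness a q - q‖ ≤ a := by
  have hs := verticalSlowness_re_pos a hq
  have hi := verticalSlowness_im_mul_nonneg a hq
  have hsq := verticalSlowness_sq a q
  set s := verticalSlowness a q
  have hle : ‖s - q‖ ≤ ‖s + q‖ := by
    rw [← sq_le_sq₀ (norm_nonneg _) (norm_nonneg _), ← normSq_eq_norm_sq, ← normSq_eq_norm_sq]
    simp only [normSq_apply, sub_re, sub_im, add_re, add_im]
    nlinarith [mul_pos hs hq]
  have hprod : ‖s - q‖ * ‖s + q‖ = a ^ 2 := by
    rw [← norm_mul, show (s - q) * (s + q) = (a : ℂ) ^ 2 by linear_combination hsq]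
    simp
  refine le_of_sq_le_sq ?_ ha
  nlinarith [norm_nonneg (s - q)]

theorem hasStrictDerivAt_verticalSlowness (a : ℝ) {q : ℂ} (hq : 0 < q.re) :
    HasStrictDerivAt (verticalSlowness a) (q / verticalSlowness a q) q := by
  have hs := sq_add_sq_mem_slitPlane a hq
  have h0 := slitPlane_ne_zero hs
  have hv : verticalSlowness a q ≠ 0 := fun h ↦ by
    simpa [h] using verticalSlowness_re_pos a hq
  have hin : HasStrictDerivAt (fun z : ℂ ↦ (a : ℂ) ^ 2 + z ^ 2) (2 * q) q := by
    simpa using! ((hasStrictDerivAt_id q).pow 2).const_add ((a : ℂ) ^ 2)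
  convert! hin.cpow_const (c := (1 : ℂ) / 2) hs using 1
  rw [cpow_sub _ _ h0, cpow_one]
  change _ = 1 / 2 * (verticalSlowness a q / _) * (2 * q)
  rw [← verticalSlowness_sq]
  field_simp

theorem div_verticalSlowness_re_pos (a : ℝ) {q : ℂ} (hq : 0 < q.re) :
    0 < (q / verticalSlowness a q).re := by
  have hs := verticalSlowness_re_pos a hq
  have hi := verticalSlowness_im_mul_nonneg a hq
  have hn : 0 < normSq (verticalSlowness a q) :=
    normSq_pos.mpr fun h ↦ by simp [h] at hs
  rw [div_re, ← add_div]
  refine div_pos ?_ hn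
  nlinarith [mul_pos hs hq]

/-- The phase `y (a² + q²)^{1/2} + h (b² + q²)^{1/2} + i q x`. -/
noncomputable def cagniardPhase (a b y h x : ℝ) (q : ℂ) : ℂ :=
  y * verticalSlowness a q + h * verticalSlowness b q + I * q * x

/-- The derivative of `cagniardPhase` on the right half-plane. -/
noncomputable def cagniardPhaseDeriv (a b y h x : ℝ) (q : ℂ) : ℂ :=
  y * (q / verticalSlowness a q) + h * (q / verticalSlowness b q) + I * x

theorem hasStrictDerivAt_cagniardPhase (a b y h x : ℝ) {q : ℂ} (hq : 0 < q.re) :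
    HasStrictDerivAt (cagniardPhase a b y h x) (cagniardPhaseDeriv a b y h x q) q := by
  have hlin : HasStrictDerivAt (fun z : ℂ ↦ I * z * x) (I * x) q := by
    simpa using ((hasStrictDerivAt_id q).const_mul I).mul_const (x : ℂ)
  exact (((hasStrictDerivAt_verticalSlowness a hq).const_mul (y : ℂ)).add
    ((hasStrictDerivAt_verticalSlowness b hq).const_mul (h : ℂ))).add hlin

theorem cagniardPhaseDeriv_re_pos (a b x : ℝ) {y h : ℝ} (hy : 0 < y) (hh : 0 < h) {q : ℂ}
    (hq : 0 < q.re) : 0 < (cagniardPhaseDeriv a b y h x q).re := by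
  have h1 := mul_pos hy (div_verticalSlowness_re_pos a hq)
  have h2 := mul_pos hh (div_verticalSlowness_re_pos b hq)
  simp only [cagniardPhaseDeriv, add_re, re_ofReal_mul, re_mul_ofReal, I_re, zero_mul]
  linarith

theorem injOn_cagniardPhase (a b x : ℝ) {y h : ℝ} (hy : 0 < y) (hh : 0 < h) :
    InjOn (cagniardPhase a b y h x) {q | 0 < q.re} :=
  injOn_of_re_deriv_pos (convex_halfSpace_re_gt 0)
    (fun _ hq ↦ (hasStrictDerivAt_cagniardPhase a b y h x hq).hasDerivAt)
    fun _ hq ↦ cagniardPhaseDeriv_re_pos a b x hy hh hq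

theorem norm_cagniardPhase_sub_le {a b y h : ℝ} (x : ℝ) (ha : 0 ≤ a) (hb : 0 ≤ b) (hy : 0 ≤ y)
    (hh : 0 ≤ h) {q : ℂ} (hq : 0 < q.re) :
    ‖cagniardPhase a b y h x q - (y + h + I * x) * q‖ ≤ y * a + h * b := by
  have hsplit : cagniardPhase a b y h x q - (y + h + I * x) * q
      = y * (verticalSlowness a q - q) + h * (verticalSlowness b q - q) := by
    rw [cagniardPhase]; ring
  rw [hsplit]
  refine (norm_add_le _ _).trans ?_
  rw [norm_mul, norm_mul, norm_real, norm_real, Real.norm_of_nonneg hy, Real.norm_of_nonneg hh]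
  gcongr
  · exact norm_verticalSlowness_sub_le ha hq
  · exact norm_verticalSlowness_sub_le hb hq

theorem isOpen_image_cagniardPhase (a b x : ℝ) {y h : ℝ} (hy : 0 < y) (hh : 0 < h) :
    IsOpen (cagniardPhase a b y h x '' {q | 0 < q.re}) := by
  rw [isOpen_iff_mem_nhds]
  rintro _ ⟨q, hq, rfl⟩
  have h0 : cagniardPhaseDeriv a b y h x q ≠ 0 := fun h0 ↦ by
    simpa [h0] using cagniardPhaseDeriv_re_pos a b x hy hh hq
  rw [← (hasStrictDerivAt_cagniardPhase a b y h x hq).map_nhds_eq h0]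
  exact image_mem_map ((isOpen_lt continuous_const continuous_re).mem_nhds hq)

/-- Every sufficiently large time is attained by the phase on the right half-plane. -/
theorem exists_large_mem_image_cagniardPhase {a b y h : ℝ} (x : ℝ) (ha : 0 ≤ a) (hb : 0 ≤ b)
    (hy : 0 < y) (hh : 0 < h) (t₀ : ℝ) :
    ∃ t : ℝ, t₀ < t ∧ (t : ℂ) ∈ cagniardPhase a b y h x '' {q | 0 < q.re} := by
  set c : ℂ := y + h + I * x with hc
  set M : ℝ := y * a + h * b + 1 with hM
  have hM0 : 0 < M := by positivity
  have hcre : c.re = y + h := by simp [hc]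
  have hc0 : c ≠ 0 := fun h0 ↦ by
    rw [h0, zero_re] at hcre; linarith
  have hcn : 0 < ‖c‖ := norm_pos_iff.mpr hc0
  set R : ℝ := 5 * M / ‖c‖ with hR
  have hR0 : 0 < R := by positivity
  have hcR : ‖c‖ * R = 5 * M := by rw [hR]; field_simp
  set t : ℝ := max (t₀ + 1) ((R + 1) * normSq c / (y + h)) with ht
  refine ⟨t, (lt_add_one t₀).trans_le (le_max_left _ _), ?_⟩
  set z₀ : ℂ := t / c with hz₀
  have hcz : c * z₀ = t := by rw [hz₀]; field_simp
  have hz₀re : R < z₀.re := by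
    have h1 : (R + 1) * normSq c / (y + h) ≤ t := le_max_right _ _
    have hn : 0 < normSq c := normSq_pos.mpr hc0
    rw [div_le_iff₀ (by positivity)] at h1
    have : z₀.re = t * (y + h) / normSq c := by
      rw [hz₀, div_re, hcre]; simp
    rw [this, lt_div_iff₀ hn]
    nlinarith
  have hball : closedBall z₀ R ⊆ {q : ℂ | 0 < q.re} := by
    intro z hz
    have h1 := (abs_re_le_norm (z - z₀)).trans (mem_closedBall_iff_norm.mp hz)
    have h2 := (abs_le.mp h1).1
    rw [sub_re] at h2
    change 0 < z.re
    linarith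
  have happrox : ∀ z ∈ closedBall z₀ R, ‖cagniardPhase a b y h x z - c * z‖ ≤ M := fun z hz ↦
    (norm_cagniardPhase_sub_le x ha hb hy.le hh.le (hball hz)).trans (by linarith)
  have hdiff : DiffContOnCl ℂ (cagniardPhase a b y h x) (ball z₀ R) := by
    refine DifferentiableOn.diffContOnCl_ball (U := {q : ℂ | 0 < q.re}) (fun z hz ↦ ?_) hball
    exact (hasStrictDerivAt_cagniardPhase a b y h x hz).hasDerivAt.differentiableAt
      |>.differentiableWithinAt
  have hz₀mem : z₀ ∈ closedBall z₀ R := mem_closedBall_self hR0.le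
  have hsphere : ∀ z ∈ sphere z₀ R,
      3 * M ≤ ‖cagniardPhase a b y h x z - cagniardPhase a b y h x z₀‖ := by
    intro z hz
    have h1 := happrox z (sphere_subset_closedBall hz)
    have h2 := happrox z₀ hz₀mem
    have h3 : ‖c * (z - z₀)‖ = 5 * M := by
      rw [norm_mul, mem_sphere_iff_norm.mp hz, hcR]
    have h4 : c * (z - z₀) = (cagniardPhase a b y h x z - cagniardPhase a b y h x z₀)
        - (cagniardPhase a b y h x z - c * z) + (cagniardPhase a b y h x z₀ - c * z₀) := by ring
    have h5 := norm_add_le ((cagniardPhase a b y h x z - cagniardPhase a b y h x z₀)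
        - (cagniardPhase a b y h x z - c * z)) (cagniardPhase a b y h x z₀ - c * z₀)
    have h6 := norm_sub_le (cagniardPhase a b y h x z - cagniardPhase a b y h x z₀)
        (cagniardPhase a b y h x z - c * z)
    rw [← h4, h3] at h5
    linarith
  have hfreq : ∃ᶠ z in 𝓝 z₀, cagniardPhase a b y h x z ≠ cagniardPhase a b y h x z₀ := by
    have hU : {q : ℂ | 0 < q.re} ∈ 𝓝 z₀ :=
      (isOpen_lt continuous_const continuous_re).mem_nhds (hball hz₀mem)
    have hne : ∃ᶠ z in 𝓝 z₀, z ≠ z₀ :=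
      frequently_iff_neBot.mpr (inferInstanceAs (NeBot (𝓝[≠] z₀)))
    refine (hne.and_eventually hU).mono fun z hz heq ↦ hz.1 ?_
    exact injOn_cagniardPhase a b x hy hh hz.2 (hball hz₀mem) heq
  have himage := hdiff.ball_subset_image_closedBall hR0 hsphere hfreq
  refine image_mono hball (himage ?_)
  rw [mem_ball_iff_norm', ← hcz]
  linarith [happrox z₀ hz₀mem]

/-- The travel time along a leg bounds the phase of any plane wave of slowness `a`, by the
Cauchy-Schwarz inequality. -/
theorem mul_sub_mul_le_sqrt_mul (a η y ξ : ℝ) (ha : 0 ≤ a) {s : ℝ} (hs : s ^ 2 = a ^ 2 - η ^ 2) :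
    y * s - ξ * η ≤ Real.sqrt (ξ ^ 2 + y ^ 2) * a := by
  refine le_of_sq_le_sq ?_ (by positivity)
  rw [mul_pow, Real.sq_sqrt (by positivity), show a ^ 2 = s ^ 2 + η ^ 2 by linarith]
  nlinarith [sq_nonneg (y * η + ξ * s)]

/-- On the imaginary axis, real values of the limiting phase do not exceed any travel time. -/
theorem le_travelTime_of_re_eq_zero {a b y h x t : ℝ} (ha : 0 < a) (hb : 0 < b) (hy : 0 < y)
    (hh : 0 < h) {q s r : ℂ} (hq : q.re = 0) (hs : s ^ 2 = (a : ℂ) ^ 2 + q ^ 2)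
    (hr : r ^ 2 = (b : ℂ) ^ 2 + q ^ 2) (hsq : 0 ≤ s.im * q.im) (hrq : 0 ≤ r.im * q.im)
    (ht : y * s + h * r + I * q * x = t) (ξ : ℝ) :
    t ≤ Real.sqrt (ξ ^ 2 + y ^ 2) * a + Real.sqrt ((x - ξ) ^ 2 + h ^ 2) * b := by
  have htre := congrArg re ht
  have htim := congrArg im ht
  simp only [add_re, add_im, mul_re, mul_im, ofReal_re, ofReal_im, I_re, I_im, hq]
    at htre htim
  have hsum : y * (s.im * q.im) + h * (r.im * q.im) = 0 := by
    linear_combination q.im * htim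
  have hsq0 : s.im * q.im = 0 := by nlinarith [mul_nonneg hh.le hrq, mul_nonneg hy.le hsq]
  have hrq0 : r.im * q.im = 0 := by nlinarith [mul_nonneg hh.le hrq, mul_nonneg hy.le hsq]
  have hre_sq : ∀ {c : ℝ} {w : ℂ}, w.im * q.im = 0 →
      w ^ 2 = (c : ℂ) ^ 2 + q ^ 2 → w.re ^ 2 = c ^ 2 - q.im ^ 2 := by
    intro c w hw0 hw
    have hre := congrArg re hw
    have hmul := re_mul_im_eq_of_sq_eq hw
    simp only [pow_two, add_re, mul_re, ofReal_re, ofReal_im, hq] at hre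
    rw [hq, zero_mul] at hmul
    have hw : w.im = 0 := by
      rcases mul_eq_zero.mp hw0 with h0 | h0
      · exact h0
      · rcases mul_eq_zero.mp hmul with h1 | h1
        · rw [h0, h1] at hre; nlinarith [mul_self_nonneg w.im]
        · exact h1
    rw [hw] at hre
    linarith
  have h1 := mul_sub_mul_le_sqrt_mul a q.im y ξ ha.le (hre_sq hsq0 hs)
  have h2 := mul_sub_mul_le_sqrt_mul b q.im h (x - ξ) hb.le (hre_sq hrq0 hr)
  linarith

/-- The times attained by the phase on the right half-plane are closed beyond the arrival time. -/
theorem closure_times_inter_Ioi_subset {a b y h x t₀ : ℝ} (ha : 0 < a) (hb : 0 < b) (hy : 0 < y)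
    (hh : 0 < h) (ht₀ : ∃ ξ : ℝ,
      t₀ = Real.sqrt (ξ ^ 2 + y ^ 2) * a + Real.sqrt ((x - ξ) ^ 2 + h ^ 2) * b) :
    closure {t : ℝ | (t : ℂ) ∈ cagniardPhase a b y h x '' {q | 0 < q.re}} ∩ Ioi t₀ ⊆
      {t : ℝ | (t : ℂ) ∈ cagniardPhase a b y h x '' {q | 0 < q.re}} := by
  rintro t ⟨htc, htt₀⟩
  obtain ⟨u, hu, hut⟩ := mem_closure_iff_seq_limit.mp htc
  choose q hq hqu using hu
  replace hq : ∀ n, 0 < (q n).re := hq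
  obtain ⟨T, hT⟩ := (isBounded_iff_forall_norm_le.mp (isBounded_range_of_tendsto u hut))
  have hu_le : ∀ n, ‖u n‖ ≤ T := fun n ↦ hT _ (mem_range_self n)
  set c : ℂ := y + h + I * x with hc
  have hc0 : 0 < ‖c‖ := norm_pos_iff.mpr fun h0 ↦ by
    have := congrArg re h0
    simp [hc] at this
    linarith
  set B : ℝ := (T + (y * a + h * b)) / ‖c‖ with hB
  have hqB : ∀ n, ‖q n‖ ≤ B := by
    intro n
    rw [hB, le_div_iff₀ hc0, mul_comm, ← norm_mul]
    have h1 := norm_cagniardPhase_sub_le x ha.le hb.le hy.le hh.le (hq n)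
    have h2 := norm_sub_le (cagniardPhase a b y h x (q n))
      (cagniardPhase a b y h x (q n) - c * q n)
    have h3 : ‖cagniardPhase a b y h x (q n)‖ ≤ T := by
      rw [hqu, norm_real]; exact hu_le n
    rw [sub_sub_cancel] at h2
    linarith
  have hsB : ∀ {d : ℝ}, 0 ≤ d → ∀ n, ‖verticalSlowness d (q n)‖ ≤ d + B := by
    intro d hd n
    have h1 := norm_add_le (verticalSlowness d (q n) - q n) (q n)
    rw [sub_add_cancel] at h1
    linarith [norm_verticalSlowness_sub_le hd (hq n), hqB n]
  have hmem : ∀ n, (q n, verticalSlowness a (q n), verticalSlowness b (q n)) ∈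
      closedBall (0 : ℂ) B ×ˢ (closedBall (0 : ℂ) (a + B) ×ˢ closedBall (0 : ℂ) (b + B)) := by
    intro n
    simp only [mem_prod, mem_closedBall_zero_iff]
    exact ⟨hqB n, hsB ha.le n, hsB hb.le n⟩
  obtain ⟨⟨q', s, r⟩, -, φ, hφ, hlim⟩ := tendsto_subseq_of_bounded
    (isBounded_closedBall.prod (isBounded_closedBall.prod isBounded_closedBall)) hmem
  have hlq : Tendsto (fun n ↦ q (φ n)) atTop (𝓝 q') := (continuous_fst.tendsto _).comp hlim
  have hls : Tendsto (fun n ↦ verticalSlowness a (q (φ n))) atTop (𝓝 s) :=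
    ((continuous_fst.comp continuous_snd).tendsto _).comp hlim
  have hlr : Tendsto (fun n ↦ verticalSlowness b (q (φ n))) atTop (𝓝 r) :=
    ((continuous_snd.comp continuous_snd).tendsto _).comp hlim
  have hre : ∀ {w : ℕ → ℂ} {z : ℂ}, Tendsto w atTop (𝓝 z) →
      Tendsto (fun n ↦ (w n).re) atTop (𝓝 z.re) := fun hw ↦ (continuous_re.tendsto _).comp hw
  have him : ∀ {w : ℕ → ℂ} {z : ℂ}, Tendsto w atTop (𝓝 z) →
      Tendsto (fun n ↦ (w n).im) atTop (𝓝 z.im) := fun hw ↦ (continuous_im.tendsto _).comp hw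
  have hq0 : 0 ≤ q'.re := ge_of_tendsto' (hre hlq) fun n ↦ (hq _).le
  have hs0 : 0 ≤ s.re := ge_of_tendsto' (hre hls) fun n ↦ (verticalSlowness_re_pos a (hq _)).le
  have hr0 : 0 ≤ r.re := ge_of_tendsto' (hre hlr) fun n ↦ (verticalSlowness_re_pos b (hq _)).le
  have hsq : 0 ≤ s.im * q'.im := ge_of_tendsto' ((him hls).mul (him hlq))
    fun n ↦ verticalSlowness_im_mul_nonneg a (hq _)
  have hrq : 0 ≤ r.im * q'.im := ge_of_tendsto' ((him hlr).mul (him hlq))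
    fun n ↦ verticalSlowness_im_mul_nonneg b (hq _)
  have hs2 : s ^ 2 = (a : ℂ) ^ 2 + q' ^ 2 := tendsto_nhds_unique
    ((hls.pow 2).congr fun n ↦ verticalSlowness_sq a _) ((hlq.pow 2).const_add _)
  have hr2 : r ^ 2 = (b : ℂ) ^ 2 + q' ^ 2 := tendsto_nhds_unique
    ((hlr.pow 2).congr fun n ↦ verticalSlowness_sq b _) ((hlq.pow 2).const_add _)
  have ht : (y : ℂ) * s + h * r + I * q' * x = t := tendsto_nhds_unique
    ((((hls.const_mul (y : ℂ)).add (hlr.const_mul (h : ℂ))).add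
      ((hlq.const_mul I).mul_const (x : ℂ))).congr fun n ↦ hqu (φ n))
    ((continuous_ofReal.tendsto t).comp (hut.comp hφ.tendsto_atTop))
  have hqpos : 0 < q'.re := by
    refine lt_of_le_of_ne hq0 fun h0 ↦ ?_
    obtain ⟨ξ, hξ⟩ := ht₀
    have := le_travelTime_of_re_eq_zero ha hb hy hh h0.symm hs2 hr2 hsq hrq ht ξ
    rw [mem_Ioi, hξ] at htt₀
    linarith
  refine ⟨q', hqpos, ?_⟩
  rw [cagniardPhase, ← eq_verticalSlowness hqpos hs0 hs2, ← eq_verticalSlowness hqpos hr0 hr2, ht]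


open Complex in
/-- For `t` beyond the geometric arrival time `t₀` (the Fermat minimum of the
travel time), the Cagniard–de Hoop equation
`y (1/V₁² + q²)^{1/2} + h (1/V₂² + q²)^{1/2} + i q x = t`
(with the principal square root) has exactly one root with positive real part. -/
theorem cagniard_root_exists_unique (y h x V₁ V₂ t₀ : ℝ)
    (hy : 0 < y) (hh : 0 < h) (hV₁ : 0 < V₁) (hV₂ : 0 < V₂)
    (ht₀ : IsLeast {s : ℝ | ∃ ξ : ℝ,
      s = Real.sqrt (ξ ^ 2 + y ^ 2) / V₁ + Real.sqrt ((x - ξ) ^ 2 + h ^ 2) / V₂} t₀) :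
    ∀ t : ℝ, t₀ < t →
      ∃! q : ℂ,
        (y : ℂ) * (1 / (V₁ : ℂ) ^ 2 + q ^ 2) ^ ((1 : ℂ) / 2) +
          (h : ℂ) * (1 / (V₂ : ℂ) ^ 2 + q ^ 2) ^ ((1 : ℂ) / 2) +
          Complex.I * q * (x : ℂ) - (t : ℂ) = 0 ∧ 0 < q.re := by
  intro t ht
  have ha : 0 < 1 / V₁ := by positivity
  have hb : 0 < 1 / V₂ := by positivity
  have harrival : ∃ ξ : ℝ, t₀ = Real.sqrt (ξ ^ 2 + y ^ 2) * (1 / V₁)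
      + Real.sqrt ((x - ξ) ^ 2 + h ^ 2) * (1 / V₂) := by
    simpa only [mul_one_div, mem_ofPred_eq] using ht₀.1
  have hsub := isPreconnected_Ioi.subset_of_closure_inter_subset
    ((isOpen_image_cagniardPhase (1 / V₁) (1 / V₂) x hy hh).preimage continuous_ofReal)
    (exists_large_mem_image_cagniardPhase x ha.le hb.le hy hh t₀)
    (closure_times_inter_Ioi_subset ha hb hy hh harrival)
  have hphase : ∀ q : ℂ, (y : ℂ) * (1 / (V₁ : ℂ) ^ 2 + q ^ 2) ^ ((1 : ℂ) / 2) +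
      (h : ℂ) * (1 / (V₂ : ℂ) ^ 2 + q ^ 2) ^ ((1 : ℂ) / 2) +
      Complex.I * q * (x : ℂ) = cagniardPhase (1 / V₁) (1 / V₂) y h x q := by
    intro q
    simp only [cagniardPhase, verticalSlowness, ofReal_div, ofReal_one, div_pow, one_pow]
  simp only [hphase, sub_eq_zero]
  obtain ⟨q, hq, hqt⟩ := hsub ht
  exact ⟨q, ⟨hqt, hq⟩, fun p hp ↦
    injOn_cagniardPhase _ _ x hy hh hp.2 hq (hp.1.trans hqt.symm)⟩
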